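/- Let u : ℝⁿ → ℝ be a smooth function with compact support and let g : ℝⁿ → ℝ be smooth. With p = (Δ²g)·u + 2∇(Δg)·∇u + 2(Δg)(Δu) + 2Δ(∇g·∇u) + 2∇g·∇(Δu), one has ∫ g·u·p dv = ∫ [ (Δg)²·u² + 4(∇g·∇u)² − 2|∇g|²·u·Δu + 4u·(Δg)·(∇g·∇u) ] dv. -/

import Mathlib

open MeasureTheory Real Filter
open scoped RealInnerProductSpace

/-- The partial derivative `∂f/∂x_m` on `ℝⁿ`. -/
noncomputable def pd {n : ℕ} (m : Fin n) (f : EuclideanSpace ℝ (Fin n) → ℝ)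
    (x : EuclideanSpace ℝ (Fin n)) : ℝ :=
  fderiv ℝ f x (EuclideanSpace.single m 1)

/-- The Laplacian `Δf = ∑ ∂²f/∂x_m²` on `ℝⁿ`. -/
noncomputable def lap {n : ℕ} (f : EuclideanSpace ℝ (Fin n) → ℝ)
    (x : EuclideanSpace ℝ (Fin n)) : ℝ :=
  ∑ m : Fin n, pd m (pd m f) x

/-- `p = (Δ²g)·u + 2∇(Δg)·∇u + 2(Δg)(Δu) + 2Δ(∇g·∇u) + 2∇g·∇(Δu)`. -/
noncomputable def pOf {n : ℕ} (g u : EuclideanSpace ℝ (Fin n) → ℝ)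
    (x : EuclideanSpace ℝ (Fin n)) : ℝ :=
  lap (lap g) x * u x + 2 * ⟪gradient (lap g) x, gradient u x⟫
    + 2 * lap g x * lap u x
    + 2 * lap (fun y => ⟪gradient g y, gradient u y⟫) x
    + 2 * ⟪gradient g x, gradient (lap u) x⟫

section Smooth

variable {n : ℕ} {f h : EuclideanSpace ℝ (Fin n) → ℝ}

lemma contDiff_pd (hf : ContDiff ℝ (⊤ : ℕ∞) f) (m : Fin n) : ContDiff ℝ (⊤ : ℕ∞) (pd m f) := by
  have : ContDiff ℝ (⊤ : ℕ∞) (fderiv ℝ f) := hf.fderiv_right (by norm_cast)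
  exact this.clm_apply contDiff_const

lemma contDiff_lap (hf : ContDiff ℝ (⊤ : ℕ∞) f) : ContDiff ℝ (⊤ : ℕ∞) (lap f) :=
  ContDiff.sum fun m _ => contDiff_pd (contDiff_pd hf m) m

lemma pd_add (hf : ContDiff ℝ (⊤ : ℕ∞) f) (hh : ContDiff ℝ (⊤ : ℕ∞) h) (m : Fin n) :
    pd m (fun x => f x + h x) = fun x => pd m f x + pd m h x := by
  funext x
  simp only [pd]
  rw [fderiv_fun_add (hf.differentiable (by simp) x) (hh.differentiable (by simp) x)]
  rfl

lemma pd_mul (hf : ContDiff ℝ (⊤ : ℕ∞) f) (hh : ContDiff ℝ (⊤ : ℕ∞) h) (m : Fin n) :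
    pd m (fun x => f x * h x) = fun x => f x * pd m h x + pd m f x * h x := by
  funext x
  simp only [pd]
  rw [fderiv_fun_mul (hf.differentiable (by simp) x) (hh.differentiable (by simp) x)]
  simp [mul_comm]

lemma lap_add (hf : ContDiff ℝ (⊤ : ℕ∞) f) (hh : ContDiff ℝ (⊤ : ℕ∞) h) :
    lap (fun x => f x + h x) = fun x => lap f x + lap h x := by
  funext x
  simp only [lap]
  rw [← Finset.sum_add_distrib]
  refine Finset.sum_congr rfl fun m _ => ?_
  rw [pd_add hf hh, pd_add (contDiff_pd hf m) (contDiff_pd hh m)]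

lemma inner_gradient_eq_sum (f h : EuclideanSpace ℝ (Fin n) → ℝ)
    (x : EuclideanSpace ℝ (Fin n)) :
    ⟪gradient f x, gradient h x⟫ = ∑ m, pd m f x * pd m h x := by
  rw [← (EuclideanSpace.basisFun (Fin n) ℝ).sum_inner_mul_inner]
  refine Finset.sum_congr rfl fun m _ => ?_
  rw [real_inner_comm (gradient h x)]
  simp [gradient, pd, InnerProductSpace.toDual_symm_apply]

lemma contDiff_inner_gradient (hf : ContDiff ℝ (⊤ : ℕ∞) f) (hh : ContDiff ℝ (⊤ : ℕ∞) h) :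
    ContDiff ℝ (⊤ : ℕ∞) (fun x => ⟪gradient f x, gradient h x⟫) := by
  simp only [inner_gradient_eq_sum]
  exact ContDiff.sum fun m _ => (contDiff_pd hf m).mul (contDiff_pd hh m)

lemma lap_mul (hf : ContDiff ℝ (⊤ : ℕ∞) f) (hh : ContDiff ℝ (⊤ : ℕ∞) h) :
    lap (fun x => f x * h x) =
      fun x => f x * lap h x + 2 * ⟪gradient f x, gradient h x⟫ + lap f x * h x := by
  funext x
  simp only [lap, inner_gradient_eq_sum, Finset.mul_sum, Finset.sum_mul]
  rw [← Finset.sum_add_distrib, ← Finset.sum_add_distrib]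
  refine Finset.sum_congr rfl fun m _ => ?_
  have hf' := contDiff_pd hf m
  have hh' := contDiff_pd hh m
  rw [pd_mul hf hh, pd_add (hf.mul hh') (hf'.mul hh), pd_mul hf hh', pd_mul hf' hh]
  ring

lemma hasCompactSupport_pd (hf : HasCompactSupport f) (m : Fin n) :
    HasCompactSupport (pd m f) :=
  hf.fderiv_apply ℝ _

lemma integrable_mul_of_hasCompactSupport (hf : ContDiff ℝ (⊤ : ℕ∞) f)
    (hfs : HasCompactSupport f) (hh : ContDiff ℝ (⊤ : ℕ∞) h) :
    Integrable (fun x => f x * h x) :=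
  (hf.continuous.mul hh.continuous).integrable_of_hasCompactSupport hfs.mul_right

lemma integral_mul_pd (hf : ContDiff ℝ (⊤ : ℕ∞) f) (hfs : HasCompactSupport f)
    (hh : ContDiff ℝ (⊤ : ℕ∞) h) (m : Fin n) :
    ∫ x, f x * pd m h x = -∫ x, pd m f x * h x :=
  integral_mul_fderiv_eq_neg_fderiv_mul_of_integrable
    (integrable_mul_of_hasCompactSupport (contDiff_pd hf m) (hasCompactSupport_pd hfs m) hh)
    (integrable_mul_of_hasCompactSupport hf hfs (contDiff_pd hh m))
    (integrable_mul_of_hasCompactSupport hf hfs hh)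
    (fun x _ => hf.differentiable (by simp) x) (fun x _ => hh.differentiable (by simp) x)

lemma integral_mul_lap (hf : ContDiff ℝ (⊤ : ℕ∞) f) (hfs : HasCompactSupport f)
    (hh : ContDiff ℝ (⊤ : ℕ∞) h) :
    ∫ x, f x * lap h x = ∫ x, lap f x * h x := by
  simp only [lap, Finset.mul_sum, Finset.sum_mul]
  rw [integral_finsetSum _ fun m _ => integrable_mul_of_hasCompactSupport hf hfs
      (contDiff_pd (contDiff_pd hh m) m),
    integral_finsetSum _ fun m _ => integrable_mul_of_hasCompactSupport
      (contDiff_pd (contDiff_pd hf m) m)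
      (hasCompactSupport_pd (hasCompactSupport_pd hfs m) m) hh]
  refine Finset.sum_congr rfl fun m _ => ?_
  rw [integral_mul_pd hf hfs (contDiff_pd hh m),
    integral_mul_pd (contDiff_pd hf m) (hasCompactSupport_pd hfs m) hh, neg_neg]

lemma hasCompactSupport_lap (hf : HasCompactSupport f) : HasCompactSupport (lap f) := by
  refine hf.mono' fun x hx => ?_
  by_contra hxf
  refine hx (Finset.sum_eq_zero fun m _ => ?_)
  have h0 (k : EuclideanSpace ℝ (Fin n) → ℝ) : tsupport (pd m k) ⊆ tsupport k :=
    tsupport_fderiv_apply_subset ℝ _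
  exact image_eq_zero_of_notMem_tsupport fun hm => hxf (h0 _ (h0 _ hm))

/-- `pOf g` is the commutator of the biharmonic operator with multiplication by `g`. -/
lemma pOf_eq_lap_lap_mul_sub {g u : EuclideanSpace ℝ (Fin n) → ℝ}
    (hg : ContDiff ℝ (⊤ : ℕ∞) g) (hu : ContDiff ℝ (⊤ : ℕ∞) u)
    (x : EuclideanSpace ℝ (Fin n)) :
    pOf g u x = lap (lap fun y => g y * u y) x - g x * lap (lap u) x := by
  have hB := contDiff_inner_gradient hg hu
  have hlg := contDiff_lap hg
  have hlu := contDiff_lap hu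
  have e : (fun y => g y * lap u y + 2 * ⟪gradient g y, gradient u y⟫ + lap g y * u y) =
      fun y => (g y * lap u y + (⟪gradient g y, gradient u y⟫ + ⟪gradient g y, gradient u y⟫))
        + lap g y * u y := by
    funext y; ring
  rw [lap_mul hg hu, e, lap_add ((hg.mul hlu).add (hB.add hB)) (hlg.mul hu),
    lap_add (hg.mul hlu) (hB.add hB), lap_add hB hB, lap_mul hg hlu, lap_mul hlg hu, pOf]
  ring

end Smooth

/-- Lemma 2.2: `∫ g·u·p = ∫ [(Δg)²u² + 4(∇g·∇u)² − 2|∇g|²·u·Δu + 4u·Δg·(∇g·∇u)]`. -/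
theorem clamped_plate_gup_integral {n : ℕ} (hn : 1 ≤ n)
    (u g : EuclideanSpace ℝ (Fin n) → ℝ)
    (hu : ContDiff ℝ (⊤ : ℕ∞) u) (hus : HasCompactSupport u)
    (hg : ContDiff ℝ (⊤ : ℕ∞) g) :
    (∫ x, g x * u x * pOf g u x) =
      ∫ x, ((lap g x) ^ 2 * u x ^ 2 + 4 * ⟪gradient g x, gradient u x⟫ ^ 2
        - 2 * ‖gradient g x‖ ^ 2 * u x * lap u x
        + 4 * u x * lap g x * ⟪gradient g x, gradient u x⟫) := by
  have hgu := hg.mul hu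
  have hgus : HasCompactSupport (fun x => g x * u x) := hus.mul_left
  have hggu := hg.mul hgu
  have hggus : HasCompactSupport (fun x => g x * (g x * u x)) := hgus.mul_left
  have hlu := contDiff_lap hu
  have hlgu := contDiff_lap hgu
  have hlap : lap (fun x => g x * (g x * u x)) = fun x => lap (fun y => (g y * g y) * u y) x := by
    congr 1; funext x; ring
  have hgrad (x) : ⟪gradient (fun y => g y * g y) x, gradient u x⟫
      = 2 * g x * ⟪gradient g x, gradient u x⟫ := by
    simp only [inner_gradient_eq_sum, pd_mul hg hg, Finset.mul_sum]
    exact Finset.sum_congr rfl fun m _ => by ring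
  calc
    (∫ x, g x * u x * pOf g u x)
      = ∫ x, (g x * u x * lap (lap fun y => g y * u y) x
          - g x * (g x * u x) * lap (lap u) x) := by
        refine integral_congr_ae (.of_forall fun x => ?_)
        simp only [pOf_eq_lap_lap_mul_sub hg hu x]
        ring
    _ = (∫ x, lap (fun y => g y * u y) x * lap (fun y => g y * u y) x)
          - ∫ x, lap (fun y => g y * (g y * u y)) x * lap u x := by
        rw [integral_sub
          (integrable_mul_of_hasCompactSupport hgu hgus (contDiff_lap hlgu))
          (integrable_mul_of_hasCompactSupport hggu hggus (contDiff_lap hlu)),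
          integral_mul_lap hgu hgus hlgu, integral_mul_lap hggu hggus hlu]
    _ = ∫ x, (lap (fun y => g y * u y) x * lap (fun y => g y * u y) x
          - lap (fun y => g y * (g y * u y)) x * lap u x) :=
        (integral_sub
          (integrable_mul_of_hasCompactSupport hlgu (hasCompactSupport_lap hgus) hlgu)
          (integrable_mul_of_hasCompactSupport (contDiff_lap hggu)
            (hasCompactSupport_lap hggus) hlu)).symm
    _ = _ := by
        refine integral_congr_ae (.of_forall fun x => ?_)
        simp only [hlap, lap_mul (hg.mul hg) hu, lap_mul hg hg, lap_mul hg hu, hgrad,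
          real_inner_self_eq_norm_sq]
        ring
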